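/- Let A := Option Bool be the three-symbol alphabet where `some b` encodes the binary symbols 0, 1 and `none` encodes the marker x, and let L_p := { l : List A | ∃ σ : List Bool, l = σ.map some ++ [none] ++ (σ.map some).reverse } be the marked palindrome language. Let C be a finite type and f : List Bool → C a function that refines the continuation equivalence of L_p, i.e., whenever f σ₁ = f σ₂, then for every w : List A, (σ₁.map some ++ w ∈ L_p) ↔ (σ₂.map some ++ w ∈ L_p). Then f is injective, and consequently for every natural number m, 2^m ≤ Fintype.card C (so no such f into a finite set exists). -/

import Mathlib

/-- The three-symbol alphabet: `some b` encodes the binary symbols 0, 1 and `none`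
encodes the marker `x`. -/
abbrev A : Type := Option Bool

/-- The marked palindrome language `{σ x σ^R | σ ∈ {0,1}*}`. -/
def Lp : Set (List A) :=
  { l : List A | ∃ σ : List Bool, l = σ.map some ++ [none] ++ (σ.map some).reverse }

/-- The binary word before the first marker is determined by the whole word. -/
theorem map_some_append_none_cons_inj {α : Type*} {σ τ : List α} {u v : List (Option α)}
    (h : σ.map some ++ none :: u = τ.map some ++ none :: v) : σ = τ := by
  induction σ generalizing τ with
  | nil => cases τ <;> simp_all
  | cons a σ ih =>
    cases τ with
    | nil => simp at h
    | cons b τ =>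
      simp only [List.map_cons, List.cons_append, List.cons.injEq, Option.some.injEq] at h
      rw [h.1, ih h.2]

/-- A word `σ x τ^R` belongs to the marked palindrome language only if `σ = τ`. -/
theorem eq_of_marked_mem_Lp {σ τ : List Bool}
    (h : σ.map some ++ none :: (τ.map some).reverse ∈ Lp) : σ = τ := by
  obtain ⟨ρ, hρ⟩ := h
  rw [List.append_assoc, List.singleton_append] at hρ
  obtain rfl := map_some_append_none_cons_inj hρ
  have h' := List.append_cancel_left hρ
  simp only [List.cons.injEq, true_and, List.reverse_inj] at h'
  exact (List.map_injective_iff.mpr (Option.some_injective Bool) h').symm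

/-- If a function `f` into a finite type `C` refines the continuation equivalence of the
marked palindrome language, then `f` is injective and hence `2^m ≤ Fintype.card C` for
every `m` (so no such `f` into a finite set exists). -/
theorem marked_palindrome_config_lower_bound (C : Type*) [Fintype C] (f : List Bool → C)
    (hf : ∀ σ₁ σ₂ : List Bool, f σ₁ = f σ₂ →
      ∀ w : List A, (σ₁.map some ++ w ∈ Lp) ↔ (σ₂.map some ++ w ∈ Lp)) :
    Function.Injective f ∧ ∀ m : ℕ, 2 ^ m ≤ Fintype.card C := by
  have hinj : Function.Injective f := fun σ τ h =>
    eq_of_marked_mem_Lp ((hf σ τ h (none :: (τ.map some).reverse)).mpr ⟨τ, by simp⟩)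
  refine ⟨hinj, fun m => ?_⟩
  simpa using Fintype.card_le_of_injective (fun v : List.Vector Bool m => f v.toList)
    (hinj.comp List.Vector.toList_injective)
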